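/- arXiv:2401.01695 — 2 statements merged into one kernel-verified Lean document; each statement's English description precedes it below -/
import Mathlib

section
/- Let α ∈ (0,1] and let X be a Banach space whose norm has modulus of smoothness of power type 1+α, i.e. there is C > 0 with ‖x+h‖^{1+α} + ‖x−h‖^{1+α} − 2‖x‖^{1+α} ≤ C‖h‖^{1+α} for all x, h ∈ X. Let ω be an admissible modulus. Then the closure, in the Ċ^{0,ω}(X,ℝ) seminorm, of the set of real-valued C^{1,α} functions on X with bounded support, equals VC^{0,ω}(X,ℝ). -/
open Filter Set

/-- An admissible modulus of continuity `ω : (0,∞) → (0,∞)`: positive, non-decreasing,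
`ω(t) → 0` as `t → 0⁺`, `ω(t) → ∞` as `t → ∞`, `t/ω(t) → 0` as `t → 0⁺`, and doubling. -/
def Admissible (ω : ℝ → ℝ) : Prop :=
  (∀ t : ℝ, 0 < t → 0 < ω t) ∧
  (∀ s t : ℝ, 0 < s → s ≤ t → ω s ≤ ω t) ∧
  Tendsto ω (nhdsWithin 0 (Ioi 0)) (nhds 0) ∧
  Tendsto ω atTop atTop ∧
  Tendsto (fun t => t / ω t) (nhdsWithin 0 (Ioi 0)) (nhds 0) ∧
  ∃ C : ℝ, 1 < C ∧ ∀ t : ℝ, 0 < t → ω (2 * t) ≤ C * ω t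

section Defs

variable {X Y : Type*} [NormedAddCommGroup X] [NormedSpace ℝ X]
  [NormedAddCommGroup Y] [NormedSpace ℝ Y]

/-- `‖f‖_{Ċ^{0,ω}} ≤ M`. -/
def HolderLE (ω : ℝ → ℝ) (f : X → Y) (M : ℝ) : Prop :=
  ∀ x y : X, x ≠ y → ‖f x - f y‖ ≤ M * ω ‖x - y‖

/-- `f ∈ Ċ^{0,ω}(X,Y)`: the homogeneous Hölder seminorm is finite. -/
def HolderFinite (ω : ℝ → ℝ) (f : X → Y) : Prop :=
  ∃ M : ℝ, HolderLE ω f M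

/-- `f ∈ VC^{0,ω}_small(X,Y)`. -/
def VCsmall (ω : ℝ → ℝ) (f : X → Y) : Prop :=
  HolderFinite ω f ∧
    ∀ ε : ℝ, 0 < ε → ∃ δ : ℝ, 0 < δ ∧ ∀ x y : X, x ≠ y → ‖x - y‖ < δ →
      ‖f x - f y‖ ≤ ε * ω ‖x - y‖

/-- `f ∈ VC^{0,ω}_large(X,Y)`. -/
def VClarge (ω : ℝ → ℝ) (f : X → Y) : Prop :=
  HolderFinite ω f ∧
    ∀ ε : ℝ, 0 < ε → ∃ δ : ℝ, 0 < δ ∧ ∀ x y : X, δ < ‖x - y‖ →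
      ‖f x - f y‖ ≤ ε * ω ‖x - y‖

/-- `f ∈ VC^{0,ω}_far(X,Y)`. -/
def VCfar (ω : ℝ → ℝ) (f : X → Y) : Prop :=
  HolderFinite ω f ∧
    ∀ ε : ℝ, 0 < ε → ∃ δ : ℝ, 0 < δ ∧ ∀ x y : X, x ≠ y → δ < ‖x‖ → δ < ‖y‖ →
      ‖f x - f y‖ ≤ ε * ω ‖x - y‖

/-- `f ∈ VC^{0,ω}(X,Y)`, the intersection of the three vanishing classes. -/
def VCfull (ω : ℝ → ℝ) (f : X → Y) : Prop :=
  VCsmall ω f ∧ VClarge ω f ∧ VCfar ω f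

/-- `f` has bounded support: it vanishes outside some bounded set. -/
def BddSupp (f : X → Y) : Prop :=
  ∃ R : ℝ, ∀ x : X, R < ‖x‖ → f x = 0

end Defs

/-- `f : X → ℝ` is of class `C^{1,α}`: Fréchet differentiable everywhere with
`α`-Hölder derivative `Df : X → X*`. -/
def C1Alpha {X : Type*} [NormedAddCommGroup X] [NormedSpace ℝ X]
    (α : ℝ) (f : X → ℝ) : Prop :=
  Differentiable ℝ f ∧ ∃ M : ℝ, ∀ x y : X,
    ‖fderiv ℝ f x - fderiv ℝ f y‖ ≤ M * ‖x - y‖ ^ α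

section Regularity

variable {X : Type*} [NormedAddCommGroup X] [NormedSpace ℝ X]

/-- The dyadic difference quotient `2 ^ k * (v (x + 2 ^ (-k) h) - v x)`. -/
noncomputable def dyadicQuot (v : X → ℝ) (x h : X) (k : ℕ) : ℝ :=
  2 ^ k * (v (x + ((1 / 2 : ℝ) ^ k) • h) - v x)

lemma abs_dyadicQuot_add_sub_le {α M : ℝ} {v : X → ℝ}
    (hv : ∀ x h : X, |v (x + h) + v (x - h) - 2 * v x| ≤ M * ‖h‖ ^ (1 + α))
    (x h l : X) (k : ℕ) :
    |dyadicQuot v x h k + dyadicQuot v x l k - dyadicQuot v x (h + l) (k + 1)| ≤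
      M * ‖(1 / 2 : ℝ) • (h - l)‖ ^ (1 + α) * ((1 / 2 : ℝ) ^ α) ^ k := by
  set s : ℝ := (1 / 2 : ℝ) ^ k with hs
  have hs0 : 0 < s := by positivity
  have h2s : (2 : ℝ) ^ k * s = 1 := by
    rw [hs, ← mul_pow]; norm_num
  have key := hv (x + (s / 2) • (h + l)) (s • (1 / 2 : ℝ) • (h - l))
  have e1 : x + (s / 2) • (h + l) + s • (1 / 2 : ℝ) • (h - l) = x + s • h := by module
  have e2 : x + (s / 2) • (h + l) - s • (1 / 2 : ℝ) • (h - l) = x + s • l := by module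
  rw [e1, e2, norm_smul, Real.norm_of_nonneg hs0.le,
    Real.mul_rpow hs0.le (norm_nonneg _), Real.rpow_add hs0, Real.rpow_one] at key
  have hsα : s ^ α = ((1 / 2 : ℝ) ^ α) ^ k := by
    rw [hs, ← Real.rpow_natCast, ← Real.rpow_natCast, ← Real.rpow_mul (by norm_num),
      ← Real.rpow_mul (by norm_num), mul_comm]
  have e3 : dyadicQuot v x h k + dyadicQuot v x l k - dyadicQuot v x (h + l) (k + 1) =
      2 ^ k * (v (x + s • h) + v (x + s • l) - 2 * v (x + (s / 2) • (h + l))) := by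
    have : (1 / 2 : ℝ) ^ (k + 1) = s / 2 := by rw [pow_succ]; ring
    simp only [dyadicQuot, this, ← hs, pow_succ]
    ring
  rw [e3, abs_mul, abs_of_pos (by positivity : (0 : ℝ) < 2 ^ k), ← hsα]
  calc (2 : ℝ) ^ k * |v (x + s • h) + v (x + s • l) - 2 * v (x + (s / 2) • (h + l))|
      ≤ 2 ^ k * (M * (s * s ^ α * ‖(1 / 2 : ℝ) • (h - l)‖ ^ (1 + α))) := by gcongr
    _ = (2 ^ k * s) * (M * ‖(1 / 2 : ℝ) • (h - l)‖ ^ (1 + α) * s ^ α) := by ring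
    _ = _ := by rw [h2s, one_mul]

/-- A continuous function whose second differences are `O(‖h‖ ^ (1 + α))` admits first order
expansions with remainder `O(‖h‖ ^ (1 + α))`. -/
lemma exists_expansion_of_second_difference {α M : ℝ} (hα : 0 < α) (hM : 0 ≤ M) {v : X → ℝ}
    (hc : Continuous v)
    (hv : ∀ x h : X, |v (x + h) + v (x - h) - 2 * v x| ≤ M * ‖h‖ ^ (1 + α)) :
    ∃ K : ℝ, 0 ≤ K ∧ ∃ A : X → X →L[ℝ] ℝ,
      ∀ x h : X, |v (x + h) - v x - A x h| ≤ K * ‖h‖ ^ (1 + α) := by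
  set r : ℝ := (1 / 2 : ℝ) ^ α with hr
  have hr0 : 0 < r := by positivity
  have hr1 : r < 1 := Real.rpow_lt_one (by norm_num) (by norm_num) hα
  have hstep : ∀ (x h : X) (k : ℕ),
      dist (dyadicQuot v x h k) (dyadicQuot v x h (k + 1)) ≤ M * ‖h‖ ^ (1 + α) * r ^ k := by
    intro x h k
    have h1 := abs_dyadicQuot_add_sub_le hv x h 0 k
    have h0 : dyadicQuot v x 0 k = 0 := by simp [dyadicQuot]
    rw [h0, add_zero, add_zero, sub_zero] at h1
    rw [Real.dist_eq]
    refine h1.trans ?_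
    have : ‖(1 / 2 : ℝ) • h‖ ≤ ‖h‖ := by
      rw [norm_smul]; norm_num; linarith [norm_nonneg h]
    gcongr
  choose A hA using fun x h => cauchySeq_tendsto_of_complete
    (cauchySeq_of_le_geometric r _ hr1 (hstep x h))
  have hAb : ∀ x h, |v (x + h) - v x - A x h| ≤ M / (1 - r) * ‖h‖ ^ (1 + α) := by
    intro x h
    have := dist_le_of_le_geometric_of_tendsto₀ r _ hr1 (hstep x h) (hA x h)
    rw [Real.dist_eq] at this
    simp only [dyadicQuot, pow_zero, one_smul, one_mul] at this
    refine this.trans (le_of_eq (by ring))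
  have hadd : ∀ x h l, A x (h + l) = A x h + A x l := by
    intro x h l
    have h1 : Tendsto (fun k => dyadicQuot v x h k + dyadicQuot v x l k -
        dyadicQuot v x (h + l) (k + 1)) atTop (nhds (A x h + A x l - A x (h + l))) :=
      ((hA x h).add (hA x l)).sub ((hA x (h + l)).comp (tendsto_add_atTop_nat 1))
    have h2 : Tendsto (fun k : ℕ => M * ‖(1 / 2 : ℝ) • (h - l)‖ ^ (1 + α) * r ^ k) atTop
        (nhds 0) := by
      simpa using (tendsto_pow_atTop_nhds_zero_of_lt_one hr0.le hr1).const_mul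
        (M * ‖(1 / 2 : ℝ) • (h - l)‖ ^ (1 + α))
    have h3 := tendsto_nhds_unique h1
      (squeeze_zero_norm (fun k => abs_dyadicQuot_add_sub_le hv x h l k) h2)
    linarith
  have hK : 0 ≤ M / (1 - r) := div_nonneg hM (by linarith)
  have hp : (0 : ℝ) < 1 + α := by linarith
  have hcont : ∀ x, Continuous (AddMonoidHom.mk' (A x) (hadd x)) := by
    intro x
    refine continuous_of_continuousAt_zero _ ?_
    rw [ContinuousAt, map_zero]
    have h1 : Tendsto (fun h : X => |v (x + h) - v x| + M / (1 - r) * ‖h‖ ^ (1 + α)) (nhds 0)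
        (nhds 0) := by
      have : Continuous
          (fun h : X => |v (x + h) - v x| + M / (1 - r) * ‖h‖ ^ (1 + α)) := by
        have := continuous_norm (E := X) |>.rpow_const (p := 1 + α) (fun _ => Or.inr hp.le)
        fun_prop
      simpa [Real.zero_rpow hp.ne'] using this.tendsto 0
    refine squeeze_zero_norm (fun h => ?_) h1
    have h2 := hAb x h
    rw [AddMonoidHom.mk'_apply, Real.norm_eq_abs]
    have h3 := abs_sub_abs_le_abs_sub (A x h) (v (x + h) - v x)
    rw [abs_sub_comm (A x h)] at h3
    linarith
  exact ⟨M / (1 - r), hK, fun x => (AddMonoidHom.mk' (A x) (hadd x)).toRealLinearMap (hcont x),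
    hAb⟩

lemma c1Alpha_of_second_difference {α M : ℝ} (hα : 0 < α) (hM : 0 ≤ M) {v : X → ℝ}
    (hc : Continuous v)
    (hv : ∀ x h : X, |v (x + h) + v (x - h) - 2 * v x| ≤ M * ‖h‖ ^ (1 + α)) :
    C1Alpha α v := by
  obtain ⟨K, hK, A, hA⟩ := exists_expansion_of_second_difference hα hM hc hv
  have hp : (0 : ℝ) < 1 + α := by linarith
  have hd : ∀ x, HasFDerivAt v (A x) x := by
    intro x
    rw [hasFDerivAt_iff_isLittleO_nhds_zero, Asymptotics.isLittleO_iff]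
    intro c hc0
    have h1 : Tendsto (fun h : X => K * ‖h‖ ^ α) (nhds 0) (nhds 0) := by
      have : Continuous (fun h : X => K * ‖h‖ ^ α) :=
        (continuous_norm.rpow_const (fun _ => Or.inr hα.le)).const_mul K
      simpa [Real.zero_rpow hα.ne'] using this.tendsto 0
    filter_upwards [h1.eventually (ge_mem_nhds hc0)] with h hh
    calc ‖v (x + h) - v x - A x h‖ ≤ K * ‖h‖ ^ (1 + α) := hA x h
      _ = K * ‖h‖ ^ α * ‖h‖ := by
        rw [Real.rpow_add_of_nonneg (norm_nonneg h) zero_le_one hα.le, Real.rpow_one]; ring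
      _ ≤ c * ‖h‖ := by gcongr
  refine ⟨fun x => (hd x).differentiableAt, K * (2 + 2 ^ (1 + α)), fun x y => ?_⟩
  rw [(hd x).fderiv, (hd y).fderiv]
  rcases eq_or_ne x y with rfl | hxy
  · simp only [sub_self, norm_zero]; positivity
  have hr : 0 < ‖x - y‖ := norm_sub_pos_iff.2 hxy
  set r := ‖x - y‖ with hrdef
  refine ContinuousLinearMap.opNorm_le_of_unit_norm (by positivity) fun e he => ?_
  have hre : ‖r • e‖ = r := by rw [norm_smul, he, mul_one, Real.norm_of_nonneg hr.le]
  have h1 := hA x (r • e)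
  have h2 := hA y (r • e + (x - y))
  have h3 := hA y (x - y)
  have e1 : y + (r • e + (x - y)) = x + r • e := by abel
  have e2 : y + (x - y) = x := by abel
  rw [hre] at h1
  rw [← hrdef, e2] at h3
  rw [e1, map_add] at h2
  have h4 : ‖r • e + (x - y)‖ ^ (1 + α) ≤ 2 ^ (1 + α) * r ^ (1 + α) := by
    rw [← Real.mul_rpow zero_le_two hr.le]
    refine Real.rpow_le_rpow (norm_nonneg _) ?_ hp.le
    refine (norm_add_le _ _).trans ?_
    rw [hre]; linarith
  have h5 : |r * (A x e - A y e)| ≤ K * (2 + 2 ^ (1 + α)) * r ^ (1 + α) := by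
    have h6 := mul_le_mul_of_nonneg_left h4 hK
    simp only [map_smul, smul_eq_mul] at h1 h2
    rw [abs_le] at h1 h2 h3 ⊢
    constructor <;> nlinarith [h1.1, h1.2, h2.1, h2.2, h3.1, h3.2]
  rw [abs_mul, abs_of_pos hr, Real.rpow_add hr, Real.rpow_one] at h5
  rw [sub_apply, Real.norm_eq_abs]
  refine le_of_mul_le_mul_left (h5.trans (le_of_eq ?_)) hr
  ring

end Regularity

section Hull

variable {X : Type*} [NormedAddCommGroup X]

/-- `w` is midpoint paraconvex of order `p` with constant `μ`: its second differences are bounded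
below by `-μ ‖h‖ ^ p`. -/
def MidParaconvex (p μ : ℝ) (w : X → ℝ) : Prop :=
  ∀ x h : X, -(μ * ‖h‖ ^ p) ≤ w (x + h) + w (x - h) - 2 * w x

/-- The largest midpoint paraconvex minorant of `u`. -/
noncomputable def paraconvexHull (p μ : ℝ) (u : X → ℝ) (x : X) : ℝ :=
  sSup {r : ℝ | ∃ w : X → ℝ, MidParaconvex p μ w ∧ (∀ y, w y ≤ u y) ∧ w x = r}

variable {p μ : ℝ} {u : X → ℝ}

lemma le_paraconvexHull {w : X → ℝ} (hw : MidParaconvex p μ w) (hwu : ∀ y, w y ≤ u y) (x : X) :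
    w x ≤ paraconvexHull p μ u x :=
  le_csSup ⟨u x, by rintro _ ⟨w, -, hw, rfl⟩; exact hw x⟩ ⟨w, hw, hwu, rfl⟩

lemma midParaconvex_const (hμ : 0 ≤ μ) (b : ℝ) : MidParaconvex p μ (fun _ : X => b) := by
  intro x h
  have : 0 ≤ μ * ‖h‖ ^ p := by positivity
  linarith

lemma paraconvexHull_le_of_forall (hμ : 0 ≤ μ) {b : ℝ} (hb : ∀ y, b ≤ u y) {x : X} {a : ℝ}
    (ha : ∀ w : X → ℝ, MidParaconvex p μ w → (∀ y, w y ≤ u y) → w x ≤ a) :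
    paraconvexHull p μ u x ≤ a :=
  csSup_le ⟨b, _, midParaconvex_const hμ b, hb, rfl⟩
    (by rintro _ ⟨w, hw, hwu, rfl⟩; exact ha w hw hwu)

lemma paraconvexHull_le (hμ : 0 ≤ μ) {b : ℝ} (hb : ∀ y, b ≤ u y) (x : X) :
    paraconvexHull p μ u x ≤ u x :=
  paraconvexHull_le_of_forall hμ hb fun _ _ hwu => hwu x

lemma midParaconvex_paraconvexHull (hμ : 0 ≤ μ) {b : ℝ} (hb : ∀ y, b ≤ u y) :
    MidParaconvex p μ (paraconvexHull p μ u) := by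
  intro x h
  have : paraconvexHull p μ u x ≤
      (paraconvexHull p μ u (x + h) + paraconvexHull p μ u (x - h) + μ * ‖h‖ ^ p) / 2 := by
    refine paraconvexHull_le_of_forall hμ hb fun w hw hwu => ?_
    have h1 := le_paraconvexHull hw hwu (x + h)
    have h2 := le_paraconvexHull hw hwu (x - h)
    have h3 := hw x h
    linarith
  linarith

lemma paraconvexHull_le_translate (hμ : 0 ≤ μ) {b : ℝ} (hb : ∀ y, b ≤ u y) {k : X} {m : ℝ}
    (hk : ∀ x, u x ≤ u (x + k) + m) (x : X) :
    paraconvexHull p μ u x ≤ paraconvexHull p μ u (x + k) + m := by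
  refine paraconvexHull_le_of_forall hμ hb fun w hw hwu => ?_
  have h1 := le_paraconvexHull (p := p) (μ := μ) (u := u) (w := fun y => w (y - k) - m)
    (fun y h => by
      have := hw (y - k) h
      beta_reduce
      rw [show y + h - k = y - k + h by abel, show y - h - k = y - k - h by abel]
      linarith)
    (fun y => by
      have h2 := hk (y - k)
      have h3 := hwu (y - k)
      rw [sub_add_cancel] at h2
      linarith) (x + k)
  simp only [add_sub_cancel_right] at h1
  linarith

/-- The paraconvex hull preserves upper bounds on second differences. -/
lemma paraconvexHull_second_difference_le (hμ : 0 ≤ μ) {b : ℝ} (hb : ∀ y, b ≤ u y) {h : X} {K : ℝ}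
    (hK : ∀ x, u (x + h) + u (x - h) - 2 * u x ≤ K) (x : X) :
    paraconvexHull p μ u (x + h) + paraconvexHull p μ u (x - h) - 2 * paraconvexHull p μ u x
      ≤ K := by
  have hP := midParaconvex_paraconvexHull (p := p) hμ hb
  have h1 := le_paraconvexHull (p := p) (μ := μ) (u := u)
    (w := fun y => (paraconvexHull p μ u (y + h) + paraconvexHull p μ u (y - h) - K) / 2)
    (fun y l => by
      have h2 := hP (y + h) l
      have h3 := hP (y - h) l
      beta_reduce
      rw [show y + l + h = y + h + l by abel, show y - l + h = y + h - l by abel,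
        show y + l - h = y - h + l by abel, show y - l - h = y - h - l by abel]
      linarith)
    (fun y => by
      have h2 := paraconvexHull_le (p := p) hμ hb (y + h)
      have h3 := paraconvexHull_le (p := p) hμ hb (y - h)
      have h4 := hK y
      linarith) x
  linarith

lemma sub_le_paraconvexHull {C c m : ℝ} (hm : 0 ≤ m)
    (hsmooth : ∀ x h : X, ‖x + h‖ ^ p + ‖x - h‖ ^ p - 2 * ‖x‖ ^ p ≤ C * ‖h‖ ^ p)
    (hμ : m * C ≤ μ) (hp : p ≠ 0) {x₀ : X} (hu : ∀ x, u x₀ ≤ u x + c + m * ‖x - x₀‖ ^ p) :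
    u x₀ - c ≤ paraconvexHull p μ u x₀ := by
  have h1 := le_paraconvexHull (p := p) (μ := μ) (u := u)
    (w := fun y => u x₀ - c - m * ‖y - x₀‖ ^ p)
    (fun y h => by
      have h2 := mul_le_mul_of_nonneg_left (hsmooth (y - x₀) h) hm
      have h3 : m * C * ‖h‖ ^ p ≤ μ * ‖h‖ ^ p := by gcongr
      beta_reduce
      rw [show y + h - x₀ = y - x₀ + h by abel, show y - h - x₀ = y - x₀ - h by abel]
      linarith)
    (fun y => by linarith [hu y]) x₀
  simpa [Real.zero_rpow hp] using h1

end Hull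

section Approximation

variable {X : Type*} [NormedAddCommGroup X]

lemma abs_paraconvexHull_translate_le {p μ : ℝ} {u : X → ℝ} (hμ : 0 ≤ μ) {b : ℝ}
    (hb : ∀ y, b ≤ u y) {k : X} {e : ℝ} (hk : ∀ x, |u (x + k) - u x| ≤ e) (x : X) :
    |paraconvexHull p μ u (x + k) - paraconvexHull p μ u x| ≤ e := by
  have h1 := paraconvexHull_le_translate (p := p) hμ hb (k := k) (m := e)
    (fun y => by linarith [(abs_le.1 (hk y)).1]) x
  have h2 := paraconvexHull_le_translate (p := p) hμ hb (k := -k) (m := e)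
    (fun y => by
      have := (abs_le.1 (hk (y + -k))).2
      rw [neg_add_cancel_right] at this
      linarith) (x + k)
  rw [add_neg_cancel_right] at h2
  exact abs_le.2 ⟨by linarith, by linarith⟩

/-- `u` is bounded by `m`, vanishes outside the ball of radius `R`, and its oscillation at
distance `t` is at most `c + m t ^ p`. -/
structure Tame (p c m R : ℝ) (u : X → ℝ) : Prop where
  bdd : ∀ x, |u x| ≤ m
  osc : ∀ x k, |u (x + k) - u x| ≤ c + m * ‖k‖ ^ p
  eq_zero : ∀ x, R < ‖x‖ → u x = 0

namespace Tame

variable {p c m R C : ℝ} {u : X → ℝ}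

lemma neg (hu : Tame p c m R u) : Tame p c m R (fun x => -u x) where
  bdd x := by rw [abs_neg]; exact hu.bdd x
  osc x k := by rw [neg_sub_neg, abs_sub_comm]; exact hu.osc x k
  eq_zero x hx := by rw [hu.eq_zero x hx, neg_zero]

lemma nonneg (hu : Tame p c m R u) : 0 ≤ m := (abs_nonneg _).trans (hu.bdd 0)

lemma neg_le (hu : Tame p c m R u) (x : X) : -m ≤ u x := (abs_le.1 (hu.bdd x)).1

lemma sub_le_hull (hu : Tame p c m R u) (hp : p ≠ 0)
    (hsmooth : ∀ x h : X, ‖x + h‖ ^ p + ‖x - h‖ ^ p - 2 * ‖x‖ ^ p ≤ C * ‖h‖ ^ p) (x : X) :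
    u x - c ≤ paraconvexHull p (m * C) u x := by
  refine sub_le_paraconvexHull hu.nonneg hsmooth le_rfl hp fun y => ?_
  have := (abs_le.1 (hu.osc x (y - x))).1
  rw [add_sub_cancel] at this
  linarith

lemma hull (hu : Tame p c m R u) (hp : 0 < p) (hC : 0 ≤ C)
    (hsmooth : ∀ x h : X, ‖x + h‖ ^ p + ‖x - h‖ ^ p - 2 * ‖x‖ ^ p ≤ C * ‖h‖ ^ p) :
    Tame p c m (R + 1) (paraconvexHull p (m * C) u) := by
  have hμ : 0 ≤ m * C := mul_nonneg hu.nonneg hC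
  refine ⟨fun x => ?_, fun x k => ?_, fun x hx => ?_⟩
  · exact abs_le.2 ⟨le_paraconvexHull (midParaconvex_const hμ (-m)) hu.neg_le x,
      (paraconvexHull_le hμ hu.neg_le x).trans ((le_abs_self _).trans (hu.bdd x))⟩
  · exact abs_paraconvexHull_translate_le hμ hu.neg_le (fun y => hu.osc y k) x
  · have h0 : u x = 0 := hu.eq_zero x (by linarith)
    refine le_antisymm ((paraconvexHull_le hμ hu.neg_le x).trans h0.le) ?_
    have h1 := sub_le_paraconvexHull (u := u) (c := 0) (x₀ := x) hu.nonneg hsmooth le_rfl hp.ne'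
      fun y => by
        rcases le_or_gt 1 ‖y - x‖ with hy | hy
        · have h2 := mul_le_mul_of_nonneg_left (Real.one_le_rpow hy hp.le) hu.nonneg
          linarith [hu.neg_le y]
        · have h2 : R < ‖y‖ := by linarith [norm_le_norm_add_norm_sub' x y, norm_sub_rev x y]
          have h3 : 0 ≤ m * ‖y - x‖ ^ p := mul_nonneg hu.nonneg (by positivity)
          rw [h0, hu.eq_zero y h2]
          linarith
    linarith

end Tame

variable [NormedSpace ℝ X]

/-- A uniformly continuous tame function is approximated by a `C^{1,α}` function of bounded
support which inherits every bound on translation differences. -/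
lemma Tame.exists_c1Alpha {α C c m R : ℝ} (hα : 0 < α) (hC : 0 ≤ C)
    (hsmooth : ∀ x h : X,
      ‖x + h‖ ^ (1 + α) + ‖x - h‖ ^ (1 + α) - 2 * ‖x‖ ^ (1 + α) ≤ C * ‖h‖ ^ (1 + α))
    {u : X → ℝ} (hu : Tame (1 + α) c m R u) (huc : UniformContinuous u) :
    ∃ v : X → ℝ, C1Alpha α v ∧ BddSupp v ∧ (∀ x, |u x - v x| ≤ c) ∧
      ∀ k e, (∀ x, |u (x + k) - u x| ≤ e) → ∀ x, |v (x + k) - v x| ≤ e := by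
  have hp : (0 : ℝ) < 1 + α := by linarith
  have hμ : 0 ≤ m * C := mul_nonneg hu.nonneg hC
  set U : X → ℝ := fun x => -paraconvexHull (1 + α) (m * C) (fun y => -u y) x with hU
  have hUt : Tame (1 + α) c m (R + 1) U := (hu.neg.hull hp hC hsmooth).neg
  set V : X → ℝ := paraconvexHull (1 + α) (m * C) U with hV
  have hVt : Tame (1 + α) c m (R + 1 + 1) V := hUt.hull hp hC hsmooth
  have htrans : ∀ k e, (∀ x, |u (x + k) - u x| ≤ e) → ∀ x, |V (x + k) - V x| ≤ e := by
    intro k e hk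
    refine abs_paraconvexHull_translate_le hμ hUt.neg_le fun x => ?_
    have := abs_paraconvexHull_translate_le (p := 1 + α) hμ hu.neg.neg_le (k := k) (e := e)
      (fun y => by rw [neg_sub_neg, abs_sub_comm]; exact hk y) x
    rwa [hU, neg_sub_neg, abs_sub_comm]
  have hVc : Continuous V := by
    rw [Metric.continuous_iff]
    intro x e he
    obtain ⟨δ, hδ, h⟩ := Metric.uniformContinuous_iff.1 huc (e / 2) (by linarith)
    refine ⟨δ, hδ, fun y hy => ?_⟩
    have h1 := htrans (y - x) (e / 2) (fun z => by
      have := h (a := z + (y - x)) (b := z) (by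
        rwa [dist_eq_norm, add_sub_cancel_left, ← dist_eq_norm])
      rw [Real.dist_eq] at this
      exact this.le) x
    rw [add_sub_cancel] at h1
    rw [Real.dist_eq]
    linarith
  refine ⟨V, c1Alpha_of_second_difference hα hμ hVc fun x h => ?_, ⟨_, hVt.eq_zero⟩,
    fun x => ?_, htrans⟩
  · refine abs_le.2 ⟨midParaconvex_paraconvexHull hμ hUt.neg_le x h, ?_⟩
    refine paraconvexHull_second_difference_le hμ hUt.neg_le (fun y => ?_) x
    have := midParaconvex_paraconvexHull (p := 1 + α) hμ hu.neg.neg_le y h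
    simp only [hU]
    linarith
  · have h1 := hUt.sub_le_hull hp.ne' hsmooth x
    have h2 := paraconvexHull_le (p := 1 + α) hμ hUt.neg_le x
    have h3 := hu.neg.sub_le_hull hp.ne' hsmooth x
    have h4 := paraconvexHull_le (p := 1 + α) hμ hu.neg.neg_le x
    simp only [hU] at h1 h2
    refine abs_le.2 ⟨?_, ?_⟩ <;> simp only [hV, hU] <;> linarith

end Approximation

section Modulus

variable {ω : ℝ → ℝ}

namespace Admissible

lemma pos (hω : Admissible ω) {t : ℝ} (ht : 0 < t) : 0 < ω t := hω.1 t ht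

lemma mono (hω : Admissible ω) {s t : ℝ} (hs : 0 < s) (hst : s ≤ t) : ω s ≤ ω t :=
  hω.2.1 s t hs hst

lemma exists_lt_of_small (hω : Admissible ω) {η : ℝ} (hη : 0 < η) :
    ∃ δ : ℝ, 0 < δ ∧ ∀ t, 0 < t → t < δ → ω t < η := by
  obtain ⟨δ, hδ, h⟩ := mem_nhdsGT_iff_exists_Ioo_subset.1
    (hω.2.2.1.eventually (gt_mem_nhds hη))
  exact ⟨δ, hδ, fun t h0 h1 => h ⟨h0, h1⟩⟩

lemma exists_mul_le_of_small (hω : Admissible ω) {K η : ℝ} (hK : 0 ≤ K) (hη : 0 < η) :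
    ∃ δ : ℝ, 0 < δ ∧ ∀ t, 0 < t → t < δ → K * t ≤ η * ω t := by
  obtain ⟨δ, hδ, h⟩ := mem_nhdsGT_iff_exists_Ioo_subset.1
    (hω.2.2.2.2.1.eventually (gt_mem_nhds (show 0 < η / (K + 1) by positivity)))
  refine ⟨δ, hδ, fun t h0 h1 => ?_⟩
  have h2 : t / ω t < η / (K + 1) := h ⟨h0, h1⟩
  rw [div_lt_div_iff₀ (hω.pos h0) (by positivity)] at h2
  linarith

lemma exists_le_of_large (hω : Admissible ω) (K : ℝ) {η : ℝ} (hη : 0 < η) :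
    ∃ T : ℝ, 0 < T ∧ ∀ t, T ≤ t → K ≤ η * ω t := by
  obtain ⟨T, hT⟩ := eventually_atTop.1 (hω.2.2.2.1.eventually_ge_atTop (K / η))
  refine ⟨max T 1, by positivity, fun t ht => ?_⟩
  have := hT t ((le_max_left _ _).trans ht)
  rwa [div_le_iff₀' hη] at this

lemma exists_mul_min_le (hω : Admissible ω) {A η : ℝ} (hA : 0 ≤ A) (hη : 0 < η) :
    ∃ R₀ : ℝ, ∀ R, 0 < R → R₀ ≤ R → ∀ t, 0 < t → A * min 1 (t / R) ≤ η * ω t := by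
  obtain ⟨T, hT, hlarge⟩ := hω.exists_le_of_large A hη
  obtain ⟨δ, hδ, hsmall⟩ := hω.exists_mul_le_of_small hA hη
  have hpos := hω.pos hδ
  refine ⟨max 1 (A * T / (η * ω δ)), fun R hR0 hR t ht => ?_⟩
  have hR1 : 1 ≤ R := (le_max_left _ _).trans hR
  have hR2 : A * T / (η * ω δ) ≤ R := (le_max_right _ _).trans hR
  rw [div_le_iff₀ (by positivity)] at hR2
  rcases le_or_gt T t with h | h
  · refine le_trans ?_ (hlarge t h)
    exact mul_le_of_le_one_right hA (min_le_left _ _)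
  refine (mul_le_mul_of_nonneg_left (min_le_right _ _) hA).trans ?_
  rcases lt_or_ge t δ with h' | h'
  · refine le_trans ?_ (hsmall t ht h')
    gcongr
    exact div_le_self ht.le hR1
  · have h1 : η * ω δ ≤ η * ω t := by gcongr; exact hω.mono hδ h'
    refine le_trans ?_ h1
    rw [← mul_div_assoc, div_le_iff₀ hR0]
    have h2 : A * t ≤ A * T := by gcongr
    linarith

end Admissible

end Modulus

section Truncation

variable {X : Type*} [NormedAddCommGroup X] {ω : ℝ → ℝ} {f : X → ℝ}

lemma HolderFinite.exists_nonneg (hω : Admissible ω) (hf : HolderFinite ω f) :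
    ∃ M : ℝ, 0 ≤ M ∧ HolderLE ω f M := by
  obtain ⟨M, hM⟩ := hf
  refine ⟨max M 0, le_max_right _ _, fun x y hxy => (hM x y hxy).trans ?_⟩
  have := hω.pos (norm_sub_pos_iff.2 hxy)
  gcongr
  exact le_max_left _ _

lemma HolderFinite.uniformContinuous (hω : Admissible ω) (hf : HolderFinite ω f) :
    UniformContinuous f := by
  obtain ⟨M, hM0, hM⟩ := hf.exists_nonneg hω
  rw [Metric.uniformContinuous_iff]
  intro e he
  obtain ⟨δ, hδ, h⟩ := hω.exists_lt_of_small (show 0 < e / (M + 1) by positivity)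
  refine ⟨δ, hδ, fun {x y} hxy => ?_⟩
  rcases eq_or_ne x y with rfl | hne
  · simpa using he
  have h0 := norm_sub_pos_iff.2 hne
  rw [dist_eq_norm] at hxy
  have h1 := h _ h0 hxy
  rw [lt_div_iff₀ (by positivity)] at h1
  have h2 := hω.pos h0
  rw [dist_eq_norm]
  linarith [hM x y hne]

lemma HolderFinite.exists_abs_le (hω : Admissible ω) (hf : HolderFinite ω f) (hs : BddSupp f) :
    ∃ B : ℝ, ∀ x, |f x| ≤ B := by
  obtain ⟨M, hM0, hM⟩ := hf.exists_nonneg hω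
  obtain ⟨R, hR⟩ := hs
  have hpos : 0 < max R 1 := by positivity
  have hω0 := (hω.pos hpos).le
  refine ⟨|f 0| + M * ω (max R 1), fun x => ?_⟩
  rcases eq_or_ne x 0 with rfl | hx
  · have : 0 ≤ M * ω (max R 1) := by positivity
    linarith
  rcases lt_or_ge R ‖x‖ with h | h
  · rw [hR x h, abs_zero]; positivity
  have h1 := hM x 0 hx
  rw [sub_zero, Real.norm_eq_abs] at h1
  have h2 : M * ω ‖x‖ ≤ M * ω (max R 1) := by
    gcongr
    exact hω.mono (norm_pos_iff.2 hx) (h.trans (le_max_left _ _))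
  linarith [abs_sub_abs_le_abs_sub (f x) (f 0)]

/-- Radial cutoff: `1` on the ball of radius `R`, `0` outside the ball of radius `2 R`. -/
noncomputable def radialCutoff (R : ℝ) (x : X) : ℝ := max 0 (min 1 (2 - ‖x‖ / R))

lemma abs_radialCutoff_sub_le {R : ℝ} (hR : 0 < R) (x y : X) :
    |radialCutoff R x - radialCutoff R y| ≤ min 1 (‖x - y‖ / R) := by
  refine le_min ?_ ?_
  · have hx : ∀ z : X, 0 ≤ radialCutoff R z ∧ radialCutoff R z ≤ 1 := fun z =>
      ⟨le_max_left _ _, max_le zero_le_one (min_le_left _ _)⟩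
    exact abs_sub_le_of_le_of_le (hx x).1 (hx x).2 (hx y).1 (hx y).2 |>.trans (by norm_num)
  · have h1 : |radialCutoff R x - radialCutoff R y| ≤ |(2 - ‖x‖ / R) - (2 - ‖y‖ / R)| := by
      refine (abs_max_sub_max_le_max _ _ _ _).trans ?_
      rw [sub_self, abs_zero, max_eq_right (abs_nonneg _)]
      refine (abs_min_sub_min_le_max _ _ _ _).trans ?_
      rw [sub_self, abs_zero, max_eq_right (abs_nonneg _)]
    refine h1.trans ?_
    rw [show (2 - ‖x‖ / R) - (2 - ‖y‖ / R) = -((‖x‖ - ‖y‖) / R) by ring, abs_neg, abs_div,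
      abs_of_pos hR]
    gcongr
    exact abs_norm_sub_norm_le x y

variable [NormedSpace ℝ X]

/-- Growth bound obtained by chaining along a ray in steps of length at most `t`. -/
lemma abs_le_of_far (hω : Admissible ω) {M η R : ℝ} (hM0 : 0 ≤ M) (hη : 0 ≤ η) (hR : 0 < R)
    (hM : HolderLE ω f M) (h0 : f 0 = 0)
    (hfar : ∀ x y : X, x ≠ y → R < ‖x‖ → R < ‖y‖ → ‖f x - f y‖ ≤ η * ω ‖x - y‖)
    (x : X) {t : ℝ} (ht : 0 < t) :
    |f x| ≤ M * ω (R + 1) + (‖x‖ / t + 1) * (η * ω t) := by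
  have hωt := hω.pos ht
  have hω1 := hω.pos (show 0 < R + 1 by linarith)
  have hball : ∀ y : X, ‖y‖ ≤ R + 1 → |f y| ≤ M * ω (R + 1) := by
    intro y hy
    rcases eq_or_ne y 0 with rfl | hne
    · rw [h0, abs_zero]; positivity
    have h1 := hM y 0 hne
    rw [h0, sub_zero, sub_zero, Real.norm_eq_abs] at h1
    refine h1.trans ?_
    gcongr
    exact hω.mono (norm_pos_iff.2 hne) hy
  rcases le_or_gt ‖x‖ (R + 1) with hx | hx
  · have h1 : 0 ≤ (‖x‖ / t + 1) * (η * ω t) := by positivity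
    linarith [hball x hx]
  have hx0 : 0 < ‖x‖ := by linarith
  set n := ⌈(‖x‖ - (R + 1)) / t⌉₊ with hn
  have hnpos : 0 < n := Nat.ceil_pos.2 (div_pos (by linarith) ht)
  have hn0 : (0 : ℝ) < n := by exact_mod_cast hnpos
  set s := (‖x‖ - (R + 1)) / n with hs
  have hs0 : 0 < s := div_pos (by linarith) hn0
  have hst : s ≤ t := by
    rw [hs, div_le_iff₀ hn0]
    have := Nat.le_ceil ((‖x‖ - (R + 1)) / t)
    rw [div_le_iff₀ ht] at this
    linarith
  have hnt : (n : ℝ) ≤ ‖x‖ / t + 1 := by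
    have h1 := Nat.ceil_lt_add_one (div_pos (show 0 < ‖x‖ - (R + 1) by linarith) ht).le
    have h2 : (‖x‖ - (R + 1)) / t ≤ ‖x‖ / t := by gcongr; linarith
    linarith
  set e := (‖x‖)⁻¹ • x with he
  have hen : ‖e‖ = 1 := by
    rw [he, norm_smul, norm_inv, norm_norm, inv_mul_cancel₀ hx0.ne']
  have hnorm : ∀ a : ℝ, 0 < a → ‖a • e‖ = a := fun a ha => by
    rw [norm_smul, hen, mul_one, Real.norm_of_nonneg ha.le]
  have hchain : ∀ k : ℕ, |f ((R + 1 + k * s) • e)| ≤ M * ω (R + 1) + k * (η * ω t) := by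
    intro k
    induction k with
    | zero =>
      have := hball ((R + 1) • e) (hnorm _ (by linarith)).le
      simpa using this
    | succ k ih =>
      have ha : 0 ≤ (k : ℝ) * s := by positivity
      have hsub : (R + 1 + ((k + 1 : ℕ) : ℝ) * s) • e - (R + 1 + k * s) • e = s • e := by
        push_cast; module
      have hne : (R + 1 + ((k + 1 : ℕ) : ℝ) * s) • e ≠ (R + 1 + k * s) • e := by
        rw [← sub_ne_zero, hsub, ← norm_pos_iff, hnorm s hs0]; exact hs0
      have h1 := hfar _ _ hne
        (by rw [hnorm _ (by push_cast; nlinarith)]; push_cast; nlinarith)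
        (by rw [hnorm _ (by linarith)]; linarith)
      rw [hsub, hnorm s hs0, Real.norm_eq_abs] at h1
      have h2 : η * ω s ≤ η * ω t := by gcongr; exact hω.mono hs0 hst
      have h3 := abs_sub_abs_le_abs_sub (f ((R + 1 + ((k + 1 : ℕ) : ℝ) * s) • e))
        (f ((R + 1 + k * s) • e))
      have h4 : ((k + 1 : ℕ) : ℝ) * (η * ω t) = k * (η * ω t) + η * ω t := by push_cast; ring
      linarith
  have hend : (R + 1 + n * s) • e = x := by
    rw [hs, mul_div_cancel₀ _ hn0.ne', add_sub_cancel, he, smul_smul,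
      mul_inv_cancel₀ hx0.ne', one_smul]
  have h1 := hchain n
  rw [hend] at h1
  refine h1.trans ?_
  gcongr

/-- A vanishing Hölder function is approximated in the seminorm by its truncations. -/
lemma VCfull.exists_bddSupp (hω : Admissible ω) (hf : VCfull ω f) {ε : ℝ} (hε : 0 < ε) :
    ∃ u : X → ℝ, BddSupp u ∧ HolderLE ω (fun x => f x - u x) ε := by
  obtain ⟨⟨hfin, -⟩, ⟨-, hlarge⟩, ⟨-, hfar⟩⟩ := hf
  obtain ⟨M, hM0, hM⟩ := hfin.exists_nonneg hω
  set η := ε / 5 with hηdef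
  have hη : 0 < η := by positivity
  obtain ⟨L, hL, hlarge⟩ := hlarge η hη
  obtain ⟨R₀, hR₀, hfar⟩ := hfar η hη
  set F : X → ℝ := fun x => f x - f 0 with hF
  have hFsub : ∀ x y, F x - F y = f x - f y := fun x y => by simp only [hF]; ring
  set A := M * ω (R₀ + 1) with hA
  have hA0 : 0 ≤ A := mul_nonneg hM0 (hω.pos (by linarith)).le
  obtain ⟨R₁, hR₁⟩ := hω.exists_mul_min_le hA0 hη
  set R := max R₁ (R₀ + L) with hRdef
  have hRL : R₀ + L ≤ R := le_max_right _ _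
  have hR : 0 < R := by linarith
  have hgrow : ∀ (x : X) {t : ℝ}, 0 < t → |F x| ≤ A + (‖x‖ / t + 1) * (η * ω t) := fun x t ht =>
    abs_le_of_far hω hM0 hη.le hR₀ (fun x y hxy => by rw [hFsub]; exact hM x y hxy) (by simp [hF])
      (fun x y hxy hx hy => by rw [hFsub]; exact hfar x y hxy hx hy) x ht
  have hzero : ∀ x : X, 2 * R ≤ ‖x‖ → radialCutoff R x = 0 := fun x hx => by
    have : 2 ≤ ‖x‖ / R := (le_div_iff₀ hR).2 hx
    exact max_eq_left ((min_le_right _ _).trans (by linarith))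
  have hone : ∀ x : X, ‖x‖ ≤ R → radialCutoff R x = 1 := fun x hx => by
    have : ‖x‖ / R ≤ 1 := (div_le_one hR).2 hx
    rw [radialCutoff, min_eq_left (by linarith), max_eq_right zero_le_one]
  refine ⟨fun x => radialCutoff R x * F x, ⟨2 * R, fun x hx => ?_⟩, ?_⟩
  · simp only [hzero x hx.le, zero_mul]
  have main : ∀ x y : X, x ≠ y → ‖x‖ ≤ ‖y‖ →
      |(f x - radialCutoff R x * F x) - (f y - radialCutoff R y * F y)| ≤ ε * ω ‖x - y‖ := by
    intro x y hxy hle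
    have ht := norm_sub_pos_iff.2 hxy
    set t := ‖x - y‖ with htdef
    have hωt := hω.pos ht
    have e1 : (f x - radialCutoff R x * F x) - (f y - radialCutoff R y * F y) =
        (1 - radialCutoff R y) * (f x - f y) + (radialCutoff R y - radialCutoff R x) * F x := by
      linear_combination (radialCutoff R y) * hFsub x y
    have b1 : |(1 - radialCutoff R y) * (f x - f y)| ≤ η * ω t := by
      rcases le_or_gt ‖y‖ R with hy | hy
      · rw [hone y hy, sub_self, zero_mul, abs_zero]; positivity
      have h0 : 0 ≤ radialCutoff R y := le_max_left _ _
      have h1 : radialCutoff R y ≤ 1 := max_le zero_le_one (min_le_left _ _)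
      have h2 : |f x - f y| ≤ η * ω t := by
        rcases lt_or_ge R₀ ‖x‖ with hx | hx
        · exact hfar x y hxy hx (by linarith)
        · exact hlarge x y (by
            have := norm_sub_norm_le y x
            rw [norm_sub_rev] at this
            linarith)
      rw [abs_mul, abs_of_nonneg (by linarith)]
      exact (mul_le_of_le_one_left (abs_nonneg _) (by linarith)).trans h2
    have b2 : |(radialCutoff R y - radialCutoff R x) * F x| ≤ 4 * (η * ω t) := by
      rcases le_or_gt (2 * R) ‖x‖ with hx | hx
      · rw [hzero x hx, hzero y (hx.trans hle), sub_self, zero_mul, abs_zero]; positivity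
      have hd := abs_radialCutoff_sub_le hR x y
      rw [abs_sub_comm] at hd
      set d := min 1 (t / R) with hdd
      have hd0 : 0 ≤ d := le_min zero_le_one (by positivity)
      have hd1 : d ≤ 1 := min_le_left _ _
      have hd2 : d ≤ t / R := min_le_right _ _
      have h1 := hR₁ R hR (le_max_left _ _) t ht
      rw [abs_mul]
      calc |radialCutoff R y - radialCutoff R x| * |F x|
          ≤ d * (A + (2 * R / t + 1) * (η * ω t)) := by
            refine mul_le_mul hd ((hgrow x ht).trans ?_) (abs_nonneg _) hd0
            gcongr
        _ = A * d + (d * (2 * R / t) + d) * (η * ω t) := by ring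
        _ ≤ η * ω t + (2 + 1) * (η * ω t) := by
            gcongr
            calc d * (2 * R / t) ≤ t / R * (2 * R / t) := by gcongr
              _ = 2 := by field_simp
        _ = 4 * (η * ω t) := by ring
    rw [e1]
    refine (abs_add_le _ _).trans ((add_le_add b1 b2).trans (le_of_eq ?_))
    rw [hηdef]; ring
  intro x y hxy
  rw [Real.norm_eq_abs]
  rcases le_total ‖x‖ ‖y‖ with h | h
  · exact main x y hxy h
  · have := main y x hxy.symm h
    rwa [abs_sub_comm, norm_sub_rev] at this

end Truncation

section Lipschitz

variable {X : Type*} [NormedAddCommGroup X]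

lemma exists_abs_le_of_lipschitz_bound {g : X → ℝ} {L : ℝ} (hL : 0 ≤ L)
    (hg : ∀ x y : X, |g x - g y| ≤ L * ‖x - y‖) (hs : BddSupp g) :
    ∃ B : ℝ, ∀ x, |g x| ≤ B := by
  obtain ⟨R, hR⟩ := hs
  refine ⟨|g 0| + L * |R|, fun x => ?_⟩
  rcases lt_or_ge R ‖x‖ with h | h
  · rw [hR x h, abs_zero]; positivity
  have h1 := hg x 0
  rw [sub_zero] at h1
  have h2 : L * ‖x‖ ≤ L * |R| := by gcongr; exact h.trans (le_abs_self R)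
  linarith [abs_sub_abs_le_abs_sub (g x) (g 0)]

variable [NormedSpace ℝ X]

lemma C1Alpha.exists_lipschitz_bound {α : ℝ} (hα : 0 ≤ α) {g : X → ℝ} (hg : C1Alpha α g)
    (hs : BddSupp g) :
    ∃ L : ℝ, 0 ≤ L ∧ ∀ x y : X, |g x - g y| ≤ L * ‖x - y‖ := by
  rcases subsingleton_or_nontrivial X with hX | hX
  · exact ⟨0, le_rfl, fun x y => by simp [Subsingleton.elim x y]⟩
  obtain ⟨hd, M, hM⟩ := hg
  obtain ⟨R, hR⟩ := hs
  have hzero : ∀ x : X, R < ‖x‖ → fderiv ℝ g x = 0 := by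
    intro x hx
    have h1 : g =ᶠ[nhds x] fun _ => (0 : ℝ) := by
      filter_upwards [continuous_norm.continuousAt.eventually (lt_mem_nhds hx)] with y hy
      exact hR y hy
    rw [h1.fderiv_eq, fderiv_const_apply]
  obtain ⟨y₀, hy₀⟩ := NormedSpace.exists_lt_norm ℝ X R
  have hbound : ∀ x, ‖fderiv ℝ g x‖ ≤ |M| * (|R| + ‖y₀‖) ^ α := by
    intro x
    rcases lt_or_ge R ‖x‖ with h | h
    · rw [hzero x h, norm_zero]; positivity
    have h1 := hM x y₀
    rw [hzero y₀ hy₀, sub_zero] at h1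
    refine h1.trans (mul_le_mul (le_abs_self _) ?_ (by positivity) (abs_nonneg _))
    refine Real.rpow_le_rpow (norm_nonneg _) ((norm_sub_le _ _).trans ?_) hα
    linarith [le_abs_self R]
  refine ⟨|M| * (|R| + ‖y₀‖) ^ α, by positivity, fun x y => ?_⟩
  exact convex_univ.norm_image_sub_le_of_norm_fderiv_le (fun z _ => hd z)
    (fun z _ => hbound z) (mem_univ y) (mem_univ x)

end Lipschitz

section Closure

variable {X : Type*} [NormedAddCommGroup X] [NormedSpace ℝ X] {α : ℝ} {ω : ℝ → ℝ} {f : X → ℝ}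

lemma vcfull_of_approx (hα : 0 ≤ α) (hω : Admissible ω) (hf : HolderFinite ω f)
    (happ : ∀ ε : ℝ, 0 < ε → ∃ g : X → ℝ,
        C1Alpha α g ∧ BddSupp g ∧ HolderLE ω (fun x => f x - g x) ε) :
    VCfull ω f := by
  have split : ∀ {g : X → ℝ} {η : ℝ}, HolderLE ω (fun x => f x - g x) η → ∀ x y, x ≠ y →
      ‖f x - f y‖ ≤ |g x - g y| + η * ω ‖x - y‖ := by
    intro g η hg x y hxy
    have h1 := hg x y hxy
    rw [Real.norm_eq_abs] at h1 ⊢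
    have h2 := abs_add_le (g x - g y) (f x - g x - (f y - g y))
    rw [show g x - g y + (f x - g x - (f y - g y)) = f x - f y by ring] at h2
    linarith
  refine ⟨⟨hf, fun ε hε => ?_⟩, ⟨hf, fun ε hε => ?_⟩, ⟨hf, fun ε hε => ?_⟩⟩
  all_goals
    have hη : 0 < ε / 2 := by linarith
    obtain ⟨g, hg, hs, hfg⟩ := happ (ε / 2) hη
    obtain ⟨L, hL, hgL⟩ := hg.exists_lipschitz_bound hα hs
  · obtain ⟨δ, hδ, h⟩ := hω.exists_mul_le_of_small hL hη
    refine ⟨δ, hδ, fun x y hxy hlt => ?_⟩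
    linarith [split hfg x y hxy, hgL x y, h _ (norm_sub_pos_iff.2 hxy) hlt]
  · obtain ⟨B, hB⟩ := exists_abs_le_of_lipschitz_bound hL hgL hs
    obtain ⟨T, hT, h⟩ := hω.exists_le_of_large (2 * B) hη
    refine ⟨T, hT, fun x y hlt => ?_⟩
    have hxy : x ≠ y := norm_sub_pos_iff.1 (hT.trans hlt)
    linarith [split hfg x y hxy, h _ hlt.le, abs_sub (g x) (g y), hB x, hB y]
  · obtain ⟨R, hR⟩ := hs
    refine ⟨max R 1, by positivity, fun x y hxy hx hy => ?_⟩
    have h1 := split hfg x y hxy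
    rw [hR x ((le_max_left _ _).trans_lt hx), hR y ((le_max_left _ _).trans_lt hy), sub_self,
      abs_zero] at h1
    have h2 := mul_pos hη (hω.pos (norm_sub_pos_iff.2 hxy))
    linarith

/-- Boundedly supported functions with small Hölder quotients at small scales are approximated by
`C^{1,α}` functions of bounded support. -/
lemma exists_c1Alpha_holderLE {C : ℝ} (hα : 0 < α) (hC : 0 ≤ C)
    (hsmooth : ∀ x h : X,
      ‖x + h‖ ^ (1 + α) + ‖x - h‖ ^ (1 + α) - 2 * ‖x‖ ^ (1 + α) ≤ C * ‖h‖ ^ (1 + α))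
    (hω : Admissible ω) {u : X → ℝ} (hu : HolderFinite ω u) (hs : BddSupp u) {η δ : ℝ}
    (hη : 0 < η) (hδ : 0 < δ)
    (hsmall : ∀ x y : X, x ≠ y → ‖x - y‖ < δ → ‖u x - u y‖ ≤ η * ω ‖x - y‖) :
    ∃ v : X → ℝ, C1Alpha α v ∧ BddSupp v ∧ HolderLE ω (fun x => u x - v x) (2 * η) := by
  have huc := hu.uniformContinuous hω
  obtain ⟨B, hB⟩ := hu.exists_abs_le hω hs
  have hB0 : 0 ≤ B := (abs_nonneg _).trans (hB 0)
  obtain ⟨R, hR⟩ := hs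
  have hp : (0 : ℝ) < 1 + α := by linarith
  set c := η * ω δ with hc
  have hc0 : 0 < c := mul_pos hη (hω.pos hδ)
  obtain ⟨ρ, hρ, hρc⟩ := Metric.uniformContinuous_iff.1 huc c hc0
  set m := max B (2 * B / ρ ^ (1 + α)) with hm
  have hm0 : 0 ≤ m := hB0.trans (le_max_left _ _)
  have htame : Tame (1 + α) c m R u := by
    refine ⟨fun x => (hB x).trans (le_max_left _ _), fun x k => ?_, hR⟩
    rcases lt_or_ge ‖k‖ ρ with hk | hk
    · have h1 := hρc (a := x + k) (b := x) (by rwa [dist_eq_norm, add_sub_cancel_left])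
      rw [Real.dist_eq] at h1
      have h2 : 0 ≤ m * ‖k‖ ^ (1 + α) := by positivity
      linarith
    · have h1 : 2 * B ≤ m * ρ ^ (1 + α) := by
        rw [← div_le_iff₀ (by positivity)]; exact le_max_right _ _
      have h2 : m * ρ ^ (1 + α) ≤ m * ‖k‖ ^ (1 + α) := by gcongr
      linarith [abs_sub (u (x + k)) (u x), hB x, hB (x + k)]
  obtain ⟨v, hv, hvs, huv, htrans⟩ := htame.exists_c1Alpha hα hC hsmooth huc
  refine ⟨v, hv, hvs, fun x y hxy => ?_⟩
  have ht := norm_sub_pos_iff.2 hxy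
  rw [Real.norm_eq_abs]
  rcases lt_or_ge ‖x - y‖ δ with h | h
  · have h1 : ∀ z, |u (z + (x - y)) - u z| ≤ η * ω ‖x - y‖ := fun z => by
      have := hsmall (z + (x - y)) z (by simpa [sub_eq_zero] using hxy) (by simpa using h)
      simpa using this
    have h2 := htrans _ _ h1 y
    have h3 := h1 y
    rw [add_sub_cancel] at h2 h3
    have h4 := abs_sub (u x - u y) (v x - v y)
    rw [show u x - u y - (v x - v y) = u x - v x - (u y - v y) by ring] at h4
    linarith
  · have h1 : c ≤ η * ω ‖x - y‖ := by
      rw [hc]; gcongr; exact hω.mono hδ h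
    linarith [abs_sub (u x - v x) (u y - v y), huv x, huv y]

end Closure

/-- Theorem 1.4 (ii): in a super-reflexive space admitting a renorming with modulus of smoothness
of power type `1+α`, the closure of the boundedly supported `C^{1,α}` functions in the `Ċ^{0,ω}`
seminorm equals `VC^{0,ω}`. -/
theorem closure_C1alpha_bs_eq_vc
    {X : Type*} [NormedAddCommGroup X] [NormedSpace ℝ X] [CompleteSpace X]
    (α C : ℝ) (hα : α ∈ Ioc (0:ℝ) 1) (hC : 0 < C)
    (hsmooth : ∀ x h : X,
      ‖x + h‖ ^ (1 + α) + ‖x - h‖ ^ (1 + α) - 2 * ‖x‖ ^ (1 + α) ≤ C * ‖h‖ ^ (1 + α))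
    (ω : ℝ → ℝ) (hω : Admissible ω) (f : X → ℝ) :
    VCfull ω f ↔
      (HolderFinite ω f ∧ ∀ ε : ℝ, 0 < ε → ∃ g : X → ℝ,
        C1Alpha α g ∧ BddSupp g ∧
        HolderLE ω (fun x => f x - g x) ε) := by
  refine ⟨fun hf => ⟨hf.1.1, fun ε hε => ?_⟩,
    fun h => vcfull_of_approx hα.1.le hω h.1 h.2⟩
  have hη : 0 < ε / 5 := by linarith
  obtain ⟨u, hus, hfu⟩ := hf.exists_bddSupp hω hη
  have split : ∀ {M : ℝ} {x y : X}, x ≠ y → ‖f x - f y‖ ≤ M * ω ‖x - y‖ →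
      ‖u x - u y‖ ≤ (M + ε / 5) * ω ‖x - y‖ := by
    intro M x y hxy h
    have h1 := hfu x y hxy
    have h2 := norm_sub_le (f x - f y) (f x - u x - (f y - u y))
    rw [show f x - f y - (f x - u x - (f y - u y)) = u x - u y by ring] at h2
    linarith
  obtain ⟨M, hM⟩ := hf.1.1
  obtain ⟨δ, hδ, hsmall⟩ := hf.1.2 (ε / 5) hη
  obtain ⟨v, hv, hvs, huv⟩ := exists_c1Alpha_holderLE hα.1 hC.le hsmooth hω
    (η := ε / 5 + ε / 5) ⟨_, fun x y hxy => split hxy (hM x y hxy)⟩ hus (by linarith) hδ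
    (fun x y hxy h => split hxy (hsmall x y hxy h))
  refine ⟨v, hv, hvs, fun x y hxy => ?_⟩
  have h1 := hfu x y hxy
  have h2 := huv x y hxy
  have h3 := norm_add_le (f x - u x - (f y - u y)) (u x - v x - (u y - v y))
  rw [show f x - u x - (f y - u y) + (u x - v x - (u y - v y)) = f x - v x - (f y - v y) by ring]
    at h3
  linarith
end

section
/- Let A be an arbitrary index set, X = c₀(A), and let Y be a Banach space and ω an admissible modulus. Then the closure, in the Ċ^{0,ω}(X,Y) seminorm, of the set C^∞(X,Y) ∩ VC^{0,ω}_small(X,Y), equals VC^{0,ω}_small(X,Y). -/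
open Filter Set

open MeasureTheory
open scoped ZeroAtInfty Convolution

/-- A product of measures with densities has the product density. -/
theorem pi_withDensity_ofReal {ι : Type*} [Fintype ι] (ρ : ℝ → ℝ) (hρ0 : ∀ t, 0 ≤ ρ t)
    (hρi : Integrable ρ)
    [IsProbabilityMeasure (volume.withDensity fun t => ENNReal.ofReal (ρ t))] :
    Measure.pi (fun _ : ι => volume.withDensity fun t : ℝ => ENNReal.ofReal (ρ t)) =
      (volume : Measure (ι → ℝ)).withDensity fun z => ENNReal.ofReal (∏ i, ρ (z i)) := by
  refine Measure.pi_eq fun s hs => ?_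
  have hint : ∀ i, Integrable ρ (volume.restrict (s i)) := fun i => hρi.restrict
  rw [withDensity_apply _ (MeasurableSet.univ_pi hs), volume_pi, Measure.restrict_pi_pi,
    ← ofReal_integral_eq_lintegral_ofReal
      (Integrable.fintype_prod_dep (f := fun _ => ρ) hint)
      (.of_forall fun z => Finset.prod_nonneg fun i _ => hρ0 _),
    integral_fintype_prod_eq_prod (fun _ => ρ),
    ENNReal.ofReal_prod_of_nonneg fun i _ => integral_nonneg hρ0]
  refine Finset.prod_congr rfl fun i _ => ?_
  rw [withDensity_apply _ (hs i),
    ofReal_integral_eq_lintegral_ofReal (hint i) (.of_forall hρ0)]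

/-- Truncation of a real number to `[-c, c]`. -/
noncomputable def truncate (c t : ℝ) : ℝ := max (-c) (min c t)

/-- Soft thresholding at level `δ`. -/
noncomputable def softThreshold (δ t : ℝ) : ℝ := t - truncate δ t

theorem continuous_truncate (c : ℝ) : Continuous (truncate c) := by
  unfold truncate; fun_prop

theorem continuous_softThreshold (δ : ℝ) : Continuous (softThreshold δ) :=
  continuous_id.sub (continuous_truncate δ)

theorem truncate_eq_self {c t : ℝ} (h : |t| ≤ c) : truncate c t = t := by
  rw [truncate, min_eq_right (abs_le.1 h).2, max_eq_right (abs_le.1 h).1]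

theorem abs_truncate_le {c : ℝ} (hc : 0 ≤ c) (t : ℝ) : |truncate c t| ≤ c :=
  abs_le.2 ⟨le_max_left _ _, max_le (by linarith) (min_le_left _ _)⟩

theorem softThreshold_eq_zero {δ t : ℝ} (h : |t| ≤ δ) : softThreshold δ t = 0 := by
  rw [softThreshold, truncate_eq_self h, sub_self]

theorem abs_softThreshold_sub_le (δ s t : ℝ) :
    |softThreshold δ s - softThreshold δ t| ≤ |s - t| := by
  unfold softThreshold truncate
  grind

section Coordinates

variable {A : Type*} [TopologicalSpace A]

theorem norm_le_of_forall_abs_le {x : C₀(A, ℝ)} {C : ℝ} (hC : 0 ≤ C) (h : ∀ a, |x a| ≤ C) :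
    ‖x‖ ≤ C := by
  rw [← ZeroAtInftyContinuousMap.norm_toBCF_eq_norm]
  exact (BoundedContinuousFunction.norm_le hC).2 h

theorem abs_apply_le_norm (x : C₀(A, ℝ)) (a : A) : |x a| ≤ ‖x‖ := by
  rw [← ZeroAtInftyContinuousMap.norm_toBCF_eq_norm]
  exact x.toBCF.norm_coe_le_norm a

variable [DiscreteTopology A]

theorem finite_le_abs (x : C₀(A, ℝ)) {r : ℝ} (hr : 0 < r) : {a | r ≤ |x a|}.Finite := by
  have h := x.zero_at_infty'
  rw [cocompact_eq_cofinite] at h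
  have h2 := h.eventually (Metric.ball_mem_nhds 0 hr)
  refine (Filter.eventually_cofinite.1 h2).subset fun a ha => ?_
  simpa [Real.dist_eq] using ha

/-- A finitely supported family, as an element of `c₀`. -/
def ofFiniteSupport (u : A → ℝ) (hu : u.support.Finite) : C₀(A, ℝ) where
  toFun := u
  continuous_toFun := continuous_of_discreteTopology
  zero_at_infty' := by
    rw [cocompact_eq_cofinite]
    refine tendsto_const_nhds.congr' ?_
    exact Filter.eventually_cofinite.2 (hu.subset fun a ha => Ne.symm ha)

/-- Extension by zero from a finite set of coordinates. -/
noncomputable def extendZero (F : Finset A) (w : F → ℝ) : C₀(A, ℝ) :=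
  open Classical in
  ofFiniteSupport (fun a => if h : a ∈ F then w ⟨a, h⟩ else 0)
    (F.finite_toSet.subset fun a ha => by
      by_contra h
      exact ha (dif_neg h))

theorem extendZero_apply_of_mem {F : Finset A} (w : F → ℝ) {a : A} (h : a ∈ F) :
    extendZero F w a = w ⟨a, h⟩ := dif_pos h

theorem extendZero_apply_of_notMem {F : Finset A} (w : F → ℝ) {a : A} (h : a ∉ F) :
    extendZero F w a = 0 := dif_neg h

theorem continuous_extendZero (F : Finset A) : Continuous (extendZero F) := by
  refine LipschitzWith.continuous (K := 1) (LipschitzWith.of_dist_le_mul fun w w' => ?_)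
  rw [NNReal.coe_one, one_mul, dist_eq_norm, dist_eq_norm]
  refine norm_le_of_forall_abs_le (norm_nonneg _) fun a => ?_
  rw [ZeroAtInftyContinuousMap.sub_apply]
  by_cases h : a ∈ F
  · rw [extendZero_apply_of_mem _ h, extendZero_apply_of_mem _ h]
    exact norm_le_pi_norm (w - w') ⟨a, h⟩
  · rw [extendZero_apply_of_notMem _ h, extendZero_apply_of_notMem _ h]
    simp

/-- Restriction to a finite set of coordinates, as a continuous linear map. -/
noncomputable def restrictCoords (F : Finset A) : C₀(A, ℝ) →L[ℝ] (F → ℝ) :=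
  ContinuousLinearMap.pi fun a =>
    LinearMap.mkContinuous
      { toFun := fun x => x a, map_add' := fun _ _ => rfl, map_smul' := fun _ _ => rfl } 1
      fun x => by simpa using abs_apply_le_norm x a

/-- The point `x - z`, with `z` truncated to `[-δ/2, δ/2]`, soft thresholded at level `δ`
in each coordinate. -/
noncomputable def perturb {δ : ℝ} (hδ : 0 < δ) (x : C₀(A, ℝ)) (z : A → ℝ) : C₀(A, ℝ) :=
  ofFiniteSupport (fun a => softThreshold δ (x a - truncate (δ / 2) (z a)))
    ((finite_le_abs x (half_pos hδ)).subset fun a ha => by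
      by_contra h
      rw [mem_ofPred_eq, not_le] at h
      refine ha (softThreshold_eq_zero ((abs_sub _ _).trans ?_))
      linarith [abs_truncate_le (half_pos hδ).le (z a)])

variable {δ : ℝ} (hδ : 0 < δ)

theorem perturb_apply (x : C₀(A, ℝ)) (z : A → ℝ) (a : A) :
    perturb hδ x z a = softThreshold δ (x a - truncate (δ / 2) (z a)) := rfl

theorem norm_perturb_sub_perturb_le (x y : C₀(A, ℝ)) (z : A → ℝ) :
    ‖perturb hδ x z - perturb hδ y z‖ ≤ ‖x - y‖ := by
  refine norm_le_of_forall_abs_le (norm_nonneg _) fun a => ?_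
  rw [ZeroAtInftyContinuousMap.sub_apply, perturb_apply, perturb_apply]
  refine (abs_softThreshold_sub_le _ _ _).trans ?_
  rw [sub_sub_sub_cancel_right]
  exact abs_apply_le_norm (x - y) a

theorem norm_sub_perturb_le (x : C₀(A, ℝ)) (z : A → ℝ) :
    ‖x - perturb hδ x z‖ ≤ 3 / 2 * δ := by
  refine norm_le_of_forall_abs_le (by positivity) fun a => ?_
  rw [ZeroAtInftyContinuousMap.sub_apply, perturb_apply, softThreshold]
  have h1 := abs_truncate_le hδ.le (x a - truncate (δ / 2) (z a))
  have h2 := abs_truncate_le (half_pos hδ).le (z a)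
  rw [abs_le] at *
  constructor <;> linarith

theorem perturb_eq_extendZero {F : Finset A} {x : C₀(A, ℝ)} (hF : ∀ a ∉ F, |x a| ≤ δ / 2)
    (z : A → ℝ) :
    perturb hδ x z = extendZero F fun a =>
      softThreshold δ (restrictCoords F x a - truncate (δ / 2) (F.restrict z a)) := by
  ext a
  rw [perturb_apply]
  by_cases h : a ∈ F
  · rw [extendZero_apply_of_mem _ h]
    rfl
  · rw [extendZero_apply_of_notMem _ h]
    refine softThreshold_eq_zero ((abs_sub _ _).trans ?_)
    linarith [abs_truncate_le (half_pos hδ).le (z a), hF a h]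

/-- Near every point of `c₀`, all but finitely many coordinates are uniformly small. -/
theorem exists_finset_eventually_abs_le {δ : ℝ} (hδ : 0 < δ) (x₀ : C₀(A, ℝ)) :
    ∃ F : Finset A, ∀ᶠ x in nhds x₀, ∀ a ∉ F, |x a| ≤ δ / 2 := by
  refine ⟨(finite_le_abs x₀ (by positivity : 0 < δ / 4)).toFinset, ?_⟩
  filter_upwards [Metric.ball_mem_nhds x₀ (by positivity : 0 < δ / 4)] with x hx a ha
  rw [Set.Finite.mem_toFinset, mem_ofPred_eq, not_le] at ha
  rw [mem_ball_iff_norm] at hx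
  have h := abs_apply_le_norm (x - x₀) a
  rw [ZeroAtInftyContinuousMap.sub_apply] at h
  rw [abs_lt] at ha
  rw [abs_le] at *
  constructor <;> linarith

theorem continuous_comp_extendZero {Y : Type*} [TopologicalSpace Y] {f : C₀(A, ℝ) → Y}
    (hf : Continuous f) {F : Finset A} (x : C₀(A, ℝ)) :
    Continuous fun z : F → ℝ => f (extendZero F fun a =>
      softThreshold δ (restrictCoords F x a - truncate (δ / 2) (z a))) := by
  refine hf.comp ((continuous_extendZero F).comp (continuous_pi fun a => ?_))
  exact (continuous_softThreshold δ).comp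
    (continuous_const.sub ((continuous_truncate _).comp (continuous_apply a)))

variable {Y : Type*} [NormedAddCommGroup Y]

theorem integrable_comp_perturb (ν : Measure ℝ) [IsProbabilityMeasure ν]
    {f : C₀(A, ℝ) → Y} (hf : Continuous f) {B : ℝ} (x : C₀(A, ℝ))
    (hB : ∀ z, ‖f x - f (perturb hδ x z)‖ ≤ B) :
    Integrable (fun z => f (perturb hδ x z)) (Measure.infinitePi fun _ : A => ν) := by
  obtain ⟨F, hF⟩ := exists_finset_eventually_abs_le hδ x
  refine Integrable.of_bound (C := ‖f x‖ + B) ?_ (.of_forall fun z => ?_)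
  · simp_rw [perturb_eq_extendZero hδ hF.self_of_nhds]
    exact ((continuous_comp_extendZero hf x).stronglyMeasurable.comp_measurable
      (Finset.measurable_restrict F)).aestronglyMeasurable
  · have h := norm_sub_norm_le (f (perturb hδ x z)) (f x)
    rw [norm_sub_rev] at h
    linarith [hB z]

variable [NormedSpace ℝ Y]

/-- The mollification of `f`: the average of `f` over the perturbations of a point, with respect
to a product measure. -/
noncomputable def mollify (ν : Measure ℝ) (f : C₀(A, ℝ) → Y) (x : C₀(A, ℝ)) : Y :=
  ∫ z, f (perturb hδ x z) ∂Measure.infinitePi fun _ : A => ν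

variable (ν : Measure ℝ) [IsProbabilityMeasure ν]

theorem norm_mollify_sub_mollify_le [CompleteSpace Y] {f : C₀(A, ℝ) → Y} (hf : Continuous f)
    {B B' : ℝ} (hB : ∀ x z, ‖f x - f (perturb hδ x z)‖ ≤ B) (x y : C₀(A, ℝ))
    (hB' : ∀ u v, ‖u - v‖ ≤ ‖x - y‖ → ‖f u - f v‖ ≤ B') :
    ‖mollify hδ ν f x - mollify hδ ν f y‖ ≤ B' := by
  rw [mollify, mollify, ← integral_sub (integrable_comp_perturb hδ ν hf x (hB x))
    (integrable_comp_perturb hδ ν hf y (hB y))]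
  refine (norm_integral_le_of_norm_le_const (.of_forall fun z =>
    hB' _ _ (norm_perturb_sub_perturb_le hδ x y z))).trans ?_
  simp

theorem norm_sub_mollify_le [CompleteSpace Y] {f : C₀(A, ℝ) → Y} (hf : Continuous f)
    {B : ℝ} (hB : ∀ x z, ‖f x - f (perturb hδ x z)‖ ≤ B) (x : C₀(A, ℝ)) :
    ‖f x - mollify hδ ν f x‖ ≤ B := by
  have h : f x = ∫ _, f x ∂Measure.infinitePi fun _ : A => ν := by simp
  rw [h, mollify, ← integral_sub (integrable_const _) (integrable_comp_perturb hδ ν hf x (hB x))]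
  refine (norm_integral_le_of_norm_le_const (.of_forall fun z => hB x z)).trans ?_
  simp

theorem contDiff_mollify (ρ : ContDiffBump (0 : ℝ)) (hρ : ρ.rOut ≤ δ / 2)
    [IsProbabilityMeasure (volume.withDensity fun t => ENNReal.ofReal (ρ.normed volume t))]
    {f : C₀(A, ℝ) → Y} (hf : Continuous f) :
    ContDiff ℝ (⊤ : ℕ∞)
      (mollify hδ (volume.withDensity fun t => ENNReal.ofReal (ρ.normed volume t)) f) := by
  rw [contDiff_iff_contDiffAt]
  intro x₀
  obtain ⟨F, hF⟩ := exists_finset_eventually_abs_le hδ x₀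
  set p : ℝ → ℝ := ρ.normed volume with hp
  let P : (F → ℝ) → ℝ := fun z => ∏ a, p (z a)
  let K : (F → ℝ) → Y := fun w => f (extendZero F fun a => softThreshold δ (w a))
  have hpsupp : ∀ t, p t ≠ 0 → |t| < δ / 2 := fun t ht => by
    have h : t ∈ Function.support p := ht
    rw [hp, ρ.support_normed_eq, mem_ball_zero_iff, Real.norm_eq_abs] at h
    linarith
  have hp0 : ∀ t, 0 ≤ p t := ρ.nonneg_normed
  have hPc : ContDiff ℝ (⊤ : ℕ∞) P :=
    contDiff_prod fun a _ => ρ.contDiff_normed.comp (contDiff_apply ℝ ℝ a)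
  have hPs : HasCompactSupport P := by
    refine HasCompactSupport.intro (isCompact_closedBall (0 : F → ℝ) (δ / 2)) fun z hz => ?_
    by_contra h
    refine hz (mem_closedBall_zero_iff.2 ((pi_norm_le_iff_of_nonneg (by positivity)).2 fun a => ?_))
    exact (hpsupp _ (Finset.prod_ne_zero_iff.1 h a (Finset.mem_univ a))).le
  have hK : Continuous K := hf.comp ((continuous_extendZero F).comp
    (continuous_pi fun a => (continuous_softThreshold δ).comp (continuous_apply a)))
  have hconv : ContDiff ℝ (⊤ : ℕ∞) (P ⋆[ContinuousLinearMap.lsmul ℝ ℝ, volume] K) :=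
    hPs.contDiff_convolution_left _ hPc hK.locallyIntegrable
  refine (hconv.comp (restrictCoords F).contDiff).contDiffAt.congr_of_eventuallyEq ?_
  filter_upwards [hF] with x hx
  simp_rw [mollify, perturb_eq_extendZero hδ hx]
  refine (integral_restrict_infinitePi
    (μ := fun _ : A => volume.withDensity fun t => ENNReal.ofReal (p t))
    (f := fun z : F → ℝ => f (extendZero F fun a =>
      softThreshold δ (restrictCoords F x a - truncate (δ / 2) (z a))))
    (continuous_comp_extendZero hf x).aestronglyMeasurable).trans ?_
  rw [pi_withDensity_ofReal p hp0 ρ.integrable_normed,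
    integral_withDensity_eq_integral_toReal_smul hPc.continuous.measurable.ennreal_ofReal
      (.of_forall fun _ => ENNReal.ofReal_lt_top)]
  refine integral_congr_ae (.of_forall fun z => ?_)
  have hPz : 0 ≤ ∏ a, p (z a) := Finset.prod_nonneg fun a _ => hp0 _
  simp only [ENNReal.toReal_ofReal hPz, ContinuousLinearMap.lsmul_apply, P, K]
  by_cases h : ∏ a, p (z a) = 0
  · rw [h, zero_smul, zero_smul]
  · congr 3
    ext a
    rw [truncate_eq_self (hpsupp _ (Finset.prod_ne_zero_iff.1 h a (Finset.mem_univ a))).le]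
    rfl

end Coordinates

theorem HolderFinite.continuous {X Y : Type*} [NormedAddCommGroup X] [NormedSpace ℝ X]
    [NormedAddCommGroup Y] [NormedSpace ℝ Y] {ω : ℝ → ℝ}
    (hω : Tendsto ω (nhdsWithin 0 (Ioi 0)) (nhds 0)) {f : X → Y} (hf : HolderFinite ω f) :
    Continuous f := by
  obtain ⟨M, hM⟩ := hf
  rw [Metric.continuous_iff]
  intro x ε hε
  have h : Tendsto (fun t => M * ω t) (nhdsWithin 0 (Ioi 0)) (nhds 0) := by
    simpa using hω.const_mul M
  obtain ⟨δ, hδ, hlt⟩ := Metric.mem_nhdsWithin_iff.1 (h.eventually (gt_mem_nhds hε))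
  refine ⟨δ, hδ, fun y hy => ?_⟩
  rcases eq_or_ne y x with rfl | hne
  · simpa
  · rw [dist_eq_norm] at hy ⊢
    refine (hM y x hne).trans_lt (hlt ⟨?_, norm_sub_pos_iff.2 hne⟩)
    simpa using hy

/-- `VC^{0,ω}_small` is closed in the `Ċ^{0,ω}` seminorm. -/
theorem VCsmall.of_approx {X Y : Type*} [NormedAddCommGroup X] [NormedSpace ℝ X]
    [NormedAddCommGroup Y] [NormedSpace ℝ Y] {ω : ℝ → ℝ} {f : X → Y} (hf : HolderFinite ω f)
    (h : ∀ ε : ℝ, 0 < ε → ∃ g : X → Y, VCsmall ω g ∧ HolderLE ω (fun x => f x - g x) ε) :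
    VCsmall ω f := by
  refine ⟨hf, fun ε hε => ?_⟩
  obtain ⟨g, hg, hfg⟩ := h (ε / 2) (half_pos hε)
  obtain ⟨δ, hδ, hgδ⟩ := hg.2 (ε / 2) (half_pos hε)
  refine ⟨δ, hδ, fun x y hxy hlt => ?_⟩
  calc ‖f x - f y‖ = ‖(f x - g x - (f y - g y)) + (g x - g y)‖ := by congr 1; abel
    _ ≤ ε / 2 * ω ‖x - y‖ + ε / 2 * ω ‖x - y‖ :=
      norm_add_le_of_le (hfg x y hxy) (hgδ x y hxy hlt)
    _ = ε * ω ‖x - y‖ := by ring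

theorem VCsmall.exists_contDiff_approx {A : Type*} [TopologicalSpace A] [DiscreteTopology A]
    {Y : Type*} [NormedAddCommGroup Y] [NormedSpace ℝ Y] [CompleteSpace Y]
    {ω : ℝ → ℝ} (hω : Admissible ω) {f : C₀(A, ℝ) → Y} (hf : VCsmall ω f)
    {ε : ℝ} (hε : 0 < ε) :
    ∃ g : C₀(A, ℝ) → Y, ContDiff ℝ (⊤ : ℕ∞) g ∧ VCsmall ω g ∧
      HolderLE ω (fun x => f x - g x) ε := by
  obtain ⟨hpos, hmono, hzero, -, -, C, hC, hdbl⟩ := hω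
  have hcont := hf.1.continuous hzero
  obtain ⟨⟨M, hM⟩, hsmall⟩ := hf
  set η := ε / (2 * C) with hη
  have hηpos : 0 < η := by positivity
  obtain ⟨r, hr, hfr⟩ := hsmall η hηpos
  have hδ : 0 < r / 2 := half_pos hr
  set δ := r / 2 with hδr
  let ρ : ContDiffBump (0 : ℝ) := ⟨δ / 4, δ / 2, by positivity, by linarith⟩
  have hprob : IsProbabilityMeasure
      (volume.withDensity fun t => ENNReal.ofReal (ρ.normed volume t)) := by
    refine ⟨?_⟩
    rw [withDensity_apply _ MeasurableSet.univ, Measure.restrict_univ,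
      ← ofReal_integral_eq_lintegral_ofReal ρ.integrable_normed (.of_forall ρ.nonneg_normed),
      ρ.integral_normed, ENNReal.ofReal_one]
  /- A bound at distances `< s` with a nonnegative constant may be read as a bound by the modulus
  at any larger distance. -/
  have hmod : ∀ {N s : ℝ}, 0 ≤ N →
      (∀ u v : C₀(A, ℝ), u ≠ v → ‖u - v‖ < s → ‖f u - f v‖ ≤ N * ω ‖u - v‖) →
      ∀ {t : ℝ}, 0 < t → t < s → ∀ u v, ‖u - v‖ ≤ t → ‖f u - f v‖ ≤ N * ω t := by
    intro N s hN hNs t ht hts u v huv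
    rcases eq_or_ne u v with rfl | hne
    · simpa using mul_nonneg hN (hpos t ht).le
    · exact (hNs u v hne (huv.trans_lt hts)).trans
        (mul_le_mul_of_nonneg_left (hmono _ _ (norm_sub_pos_iff.2 hne) huv) hN)
  have hB : ∀ x z, ‖f x - f (perturb hδ x z)‖ ≤ η * (C * ω δ) := fun x z => by
    refine (hmod hηpos.le hfr (t := 3 / 2 * δ) (by positivity) (by linarith) _ _
      (norm_sub_perturb_le hδ x z)).trans ?_
    refine mul_le_mul_of_nonneg_left ?_ hηpos.le
    exact (hmono _ (2 * δ) (by positivity) (by linarith)).trans (hdbl δ hδ)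
  set g := mollify hδ (volume.withDensity fun t => ENNReal.ofReal (ρ.normed volume t)) f with hg
  have hgmod : ∀ {N s : ℝ}, 0 ≤ N →
      (∀ u v : C₀(A, ℝ), u ≠ v → ‖u - v‖ < s → ‖f u - f v‖ ≤ N * ω ‖u - v‖) →
      ∀ x y, x ≠ y → ‖x - y‖ < s → ‖g x - g y‖ ≤ N * ω ‖x - y‖ :=
    fun hN hNs x y hxy hlt => norm_mollify_sub_mollify_le hδ _ hcont hB x y
      (hmod hN hNs (norm_sub_pos_iff.2 hxy) hlt)
  refine ⟨g, contDiff_mollify hδ ρ le_rfl hcont, ⟨⟨max M 0, fun x y hxy => ?_⟩, fun ε' hε' => ?_⟩,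
    fun x y hxy => ?_⟩
  · refine hgmod (le_max_right _ _) (fun u v huv _ => (hM u v huv).trans ?_) x y hxy
      (lt_add_one ‖x - y‖)
    exact mul_le_mul_of_nonneg_right (le_max_left _ _) (hpos _ (norm_sub_pos_iff.2 huv)).le
  · obtain ⟨s, hs, hfs⟩ := hsmall ε' hε'
    exact ⟨s, hs, hgmod hε'.le hfs⟩
  · have hxy0 := norm_sub_pos_iff.2 hxy
    have hωxy := hpos _ hxy0
    have hηC : 2 * (η * C) = ε := by rw [hη]; field_simp
    rcases lt_or_ge ‖x - y‖ δ with hlt | hge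
    · have hlt' : ‖x - y‖ < r := by linarith
      calc ‖f x - g x - (f y - g y)‖ = ‖(f x - f y) - (g x - g y)‖ := by congr 1; abel
        _ ≤ η * ω ‖x - y‖ + η * ω ‖x - y‖ :=
          norm_sub_le_of_le (hfr x y hxy hlt') (hgmod hηpos.le hfr x y hxy hlt')
        _ = 2 * (η * 1) * ω ‖x - y‖ := by ring
        _ ≤ 2 * (η * C) * ω ‖x - y‖ := by gcongr
        _ = ε * ω ‖x - y‖ := by rw [hηC]
    · calc ‖f x - g x - (f y - g y)‖ ≤ η * (C * ω δ) + η * (C * ω δ) :=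
          norm_sub_le_of_le (norm_sub_mollify_le hδ _ hcont hB x)
            (norm_sub_mollify_le hδ _ hcont hB y)
        _ = 2 * (η * C) * ω δ := by ring
        _ = ε * ω δ := by rw [hηC]
        _ ≤ ε * ω ‖x - y‖ := mul_le_mul_of_nonneg_left (hmono _ _ hδ hge) hε.le

/-- Theorem 1.5 (i) (Theorem 5.6 (i)): for `X = c₀(𝒜)` (modelled as the space `C₀(A, ℝ)` of
functions on a discrete space `A` vanishing at infinity, with the sup norm) and `Y` a Banach
space, the closure of `C^∞(X,Y) ∩ VC^{0,ω}_small(X,Y)` in the `Ċ^{0,ω}` seminorm equals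
`VC^{0,ω}_small(X,Y)`. -/
theorem closure_smooth_vcsmall_eq_vcsmall_c0
    {A : Type*} [TopologicalSpace A] [DiscreteTopology A]
    {Y : Type*} [NormedAddCommGroup Y] [NormedSpace ℝ Y] [CompleteSpace Y]
    (ω : ℝ → ℝ) (hω : Admissible ω)
    (f : ZeroAtInftyContinuousMap A ℝ → Y) :
    VCsmall ω f ↔
      (HolderFinite ω f ∧ ∀ ε : ℝ, 0 < ε → ∃ g : ZeroAtInftyContinuousMap A ℝ → Y,
        ContDiff ℝ (⊤ : ℕ∞) g ∧ VCsmall ω g ∧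
        HolderLE ω (fun x => f x - g x) ε) := by
  refine ⟨fun hf => ⟨hf.1, fun ε hε => hf.exists_contDiff_approx hω hε⟩, fun h => ?_⟩
  refine VCsmall.of_approx h.1 fun ε hε => ?_
  obtain ⟨g, -, hg⟩ := h.2 ε hε
  exact ⟨g, hg⟩
end
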